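/- Define e_m = (1/m!)·Σ_{t ∈ I_m} r(t)·2^{m − o(t)}, the expected number of pitchforks of a coalescent-generated increasing tree of size m. Then e_2 = 1, and for every integer m ≥ 2, (m + 1)·e_{m+1} = (m − 2)·e_m + 2(m + 1)/3. -/

import Mathlib

/-- A 0-1-2-increasing tree of size `m`: vertices are `Fin m` (index `i`
represents label `i+1`, so index `0` is the root labelled `1`), encoded by a
parent function `f` with `f i < i` for every non-root vertex `i`
(and `f 0 = 0` by convention), such that every vertex has at most 2 children. -/
abbrev IncTree (m : ℕ) : Type :=
  {f : Fin m → Fin m //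
    (∀ i : Fin m, i.val = 0 → f i = i) ∧
    (∀ i : Fin m, i.val ≠ 0 → (f i).val < i.val) ∧
    (∀ j : Fin m, (Finset.univ.filter (fun i : Fin m => i.val ≠ 0 ∧ f i = j)).card ≤ 2)}

/-- The number of children of the vertex `j` in the tree `t`. -/
def numChildren {m : ℕ} (t : IncTree m) (j : Fin m) : ℕ :=
  (Finset.univ.filter (fun i : Fin m => i.val ≠ 0 ∧ t.val i = j)).card

/-- `o t`: the number of leaves (outdegree-0 vertices) of `t`. -/
def numLeaves {m : ℕ} (t : IncTree m) : ℕ :=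
  (Finset.univ.filter (fun j : Fin m => numChildren t j = 0)).card

/-- `r t`: the number of pitchforks of `t`, i.e. vertices with exactly one
child, that child being a leaf. -/
def numPitchforks {m : ℕ} (t : IncTree m) : ℕ :=
  (Finset.univ.filter (fun j : Fin m =>
    numChildren t j = 1 ∧
      ∀ i : Fin m, i.val ≠ 0 → t.val i = j → numChildren t i = 0)).card

/-- `e m`: the expected number of pitchforks of a coalescent-generated
0-1-2-increasing tree of size `m`. -/
noncomputable def expPitchforks (m : ℕ) : ℚ :=
  (1 / (Nat.factorial m : ℚ)) *
    ∑ t : IncTree m, (numPitchforks t : ℚ) * 2 ^ (m - numLeaves t)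

open Finset

theorem card_filter_castSucc {m : ℕ} (p : Fin (m+1) → Prop) [DecidablePred p] :
    (univ.filter p).card =
      (univ.filter (fun i : Fin m => p i.castSucc)).card + if p (Fin.last m) then 1 else 0 := by
  simp only [Finset.card_filter, Fin.sum_univ_castSucc]

theorem snoc_children {m : ℕ} (f : Fin m → Fin m) (j : Fin m) (k : Fin (m+1)) :
    (univ.filter (fun i : Fin (m+1) => i.val ≠ 0 ∧
      (Fin.snoc (α := fun _ => Fin (m+1)) (fun i => (f i).castSucc) j.castSucc : Fin (m+1) → Fin (m+1)) i = k)).card =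
    (univ.filter (fun i : Fin m => i.val ≠ 0 ∧ (f i).castSucc = k)).card
      + if j.castSucc = k then 1 else 0 := by
  have hm : m ≠ 0 := by have := j.2; omega
  rw [card_filter_castSucc]
  simp [hm]

def extT {m : ℕ} (t : IncTree m) (j : Fin m) (hj : numChildren t j ≤ 1) : IncTree (m+1) :=
  ⟨Fin.snoc (α := fun _ => Fin (m+1)) (fun i => (t.1 i).castSucc) j.castSucc, by
    have hm : m ≠ 0 := by have := j.2; omega
    refine ⟨?_, ?_, ?_⟩
    · intro i
      induction i using Fin.lastCases with
      | last => intro h; simp at h; omega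
      | cast i => intro h; simp at h; simpa using t.2.1 i (by simp [h])
    · intro i
      induction i using Fin.lastCases with
      | last => intro h; simp
      | cast i => intro h; simpa using t.2.2.1 i (by simpa using h)
    · intro k
      rw [snoc_children]
      induction k using Fin.lastCases with
      | last => simp [Fin.castSucc_ne_last]
      | cast k =>
        have := t.2.2.2 k
        simp only [Fin.castSucc_inj]
        split_ifs with h
        · subst h; unfold numChildren at hj; omega
        · omega⟩

theorem extT_cast {m : ℕ} (t : IncTree m) (j : Fin m) (hj : numChildren t j ≤ 1) (i : Fin m) :
    (extT t j hj).1 i.castSucc = (t.1 i).castSucc := by simp [extT]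

theorem extT_last {m : ℕ} (t : IncTree m) (j : Fin m) (hj : numChildren t j ≤ 1) :
    (extT t j hj).1 (Fin.last m) = j.castSucc := by simp [extT]

theorem nc_ext_cast {m : ℕ} (t : IncTree m) (j : Fin m) (hj : numChildren t j ≤ 1) (k : Fin m) :
    numChildren (extT t j hj) k.castSucc = numChildren t k + if j = k then 1 else 0 := by
  refine (snoc_children t.1 j k.castSucc).trans ?_
  simp [numChildren]

theorem nc_ext_last {m : ℕ} (t : IncTree m) (j : Fin m) (hj : numChildren t j ≤ 1) :
    numChildren (extT t j hj) (Fin.last m) = 0 := by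
  refine (snoc_children t.1 j (Fin.last m)).trans ?_
  simp [Fin.castSucc_ne_last]

theorem restrict_lt {m : ℕ} (hm : 1 ≤ m) (t : IncTree (m+1)) (i : Fin m) :
    (t.1 i.castSucc).val < m := by
  by_cases h : i.val = 0
  · rw [t.2.1 i.castSucc (by simpa using h)]; simp
  · have := t.2.2.1 i.castSucc (by simpa using h)
    simp at this; omega

def resT {m : ℕ} (hm : 1 ≤ m) (t : IncTree (m+1)) : IncTree m :=
  ⟨fun i => ⟨(t.1 i.castSucc).val, restrict_lt hm t i⟩, by
    refine ⟨?_, ?_, ?_⟩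
    · intro i h
      ext
      simpa using congrArg Fin.val (t.2.1 i.castSucc (by simpa using h))
    · intro i h
      simpa using t.2.2.1 i.castSucc (by simpa using h)
    · intro j
      have := t.2.2.2 j.castSucc
      rw [card_filter_castSucc] at this
      refine le_trans (le_trans (le_of_eq ?_) (Nat.le_add_right _ _)) this
      congr 1
      ext i
      simp [Fin.ext_iff]⟩

def lastP {m : ℕ} (hm : 1 ≤ m) (t : IncTree (m+1)) : Fin m :=
  ⟨(t.1 (Fin.last m)).val, by
    simpa using t.2.2.1 (Fin.last m) (by simp; omega)⟩

theorem lastP_nc {m : ℕ} (hm : 1 ≤ m) (t : IncTree (m+1)) :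
    numChildren (resT hm t) (lastP hm t) ≤ 1 := by
  have h2 := t.2.2.2 (lastP hm t).castSucc
  rw [card_filter_castSucc] at h2
  have h3 : (Fin.last m).val ≠ 0 ∧ t.1 (Fin.last m) = (lastP hm t).castSucc := by
    refine ⟨by simp; omega, ?_⟩
    ext; simp [lastP]
  rw [if_pos h3] at h2
  refine le_trans (le_of_eq ?_) (Nat.le_of_succ_le_succ h2)
  unfold numChildren
  congr 1
  ext i
  simp [Fin.ext_iff, resT]

def treeEquiv {m : ℕ} (hm : 1 ≤ m) :
    (Σ t : IncTree m, {j : Fin m // numChildren t j ≤ 1}) ≃ IncTree (m+1) where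
  toFun x := extT x.1 x.2.1 x.2.2
  invFun t := ⟨resT hm t, lastP hm t, lastP_nc hm t⟩
  left_inv := by
    rintro ⟨t, j, hj⟩
    have h1 : resT hm (extT t j hj) = t := by
      apply Subtype.ext; funext i; ext
      simp [resT, extT_cast]
    have h2 : lastP hm (extT t j hj) = j := by
      ext; simp [lastP, extT_last]
    refine Sigma.ext h1 ?_
    refine (Subtype.heq_iff_coe_eq ?_).2 h2
    intro x
    simp only [h1]
  right_inv := by
    intro t
    apply Subtype.ext; funext i
    induction i using Fin.lastCases with
    | last => ext; simp [extT_last, lastP]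
    | cast i => ext; simp [extT_cast, resT]

theorem sum_tree {m : ℕ} (hm : 1 ≤ m) (F : IncTree (m+1) → ℚ) (G : IncTree m → Fin m → ℚ)
    (h : ∀ t j hj, F (extT t j hj) = (2 - (numChildren t j : ℚ)) * G t j) :
    ∑ t, F t = ∑ t, ∑ j, (2 - (numChildren t j : ℚ)) * G t j := by
  rw [← (treeEquiv hm).sum_comp, Fintype.sum_sigma]
  refine Finset.sum_congr rfl fun t _ => ?_
  have : ∀ j : {j : Fin m // numChildren t j ≤ 1}, F (treeEquiv hm ⟨t, j⟩)
      = (2 - (numChildren t j.1 : ℚ)) * G t j.1 := fun j => h t j.1 j.2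
  rw [Finset.sum_congr rfl (fun j _ => this j)]
  rw [← Finset.sum_subtype (univ.filter (fun j => numChildren t j ≤ 1)) (by simp)
    (fun j => (2 - (numChildren t j : ℚ)) * G t j)]
  refine Finset.sum_subset (Finset.filter_subset _ _) ?_
  intro j _ hj
  have h2 := t.2.2.2 j
  change numChildren t j ≤ 2 at h2
  have h3 : numChildren t j = 2 := by simp at hj; omega
  simp [h3]

theorem nl_eq {m : ℕ} (t : IncTree m) :
    (numLeaves t : ℚ) = ∑ j, if numChildren t j = 0 then 1 else 0 := by
  simp [numLeaves]

theorem nl_ext {m : ℕ} (t : IncTree m) (j : Fin m) (hj : numChildren t j ≤ 1) :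
    numLeaves (extT t j hj) = numLeaves t + numChildren t j := by
  unfold numLeaves
  rw [card_filter_castSucc]
  simp only [nc_ext_cast, nc_ext_last, if_true]
  have : (univ.filter (fun k : Fin m => numChildren t k + (if j = k then 1 else 0) = 0))
      = (univ.filter (fun k : Fin m => numChildren t k = 0)).erase j := by
    ext k
    by_cases h : j = k
    · simp [h]
    · simp [h, Ne.symm h]
  rw [this]
  rcases Nat.le_one_iff_eq_zero_or_eq_one.1 hj with h | h
  · rw [Finset.card_erase_add_one (by simp [h]), h]; rfl
  · rw [Finset.erase_eq_of_notMem (by simp [h]), h]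

theorem nl_le {m : ℕ} (t : IncTree m) : numLeaves t ≤ m := by
  simpa [numLeaves] using Finset.card_le_univ (univ.filter (fun j : Fin m => numChildren t j = 0))

theorem w_ext {m : ℕ} (t : IncTree m) (j : Fin m) (hj : numChildren t j ≤ 1) :
    (2 : ℚ) ^ (m + 1 - numLeaves (extT t j hj))
      = (2 - (numChildren t j : ℚ)) * 2 ^ (m - numLeaves t) := by
  have := nl_le t
  rw [nl_ext]
  rcases Nat.le_one_iff_eq_zero_or_eq_one.1 hj with h | h
  · rw [h, show m + 1 - (numLeaves t + 0) = (m - numLeaves t) + 1 by omega, pow_succ]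
    push_cast; ring
  · rw [h, show m + 1 - (numLeaves t + 1) = (m - numLeaves t) by omega]
    push_cast; ring

def PF {m : ℕ} (t : IncTree m) (j : Fin m) : Prop :=
    numChildren t j = 1 ∧
      ∀ i : Fin m, i.val ≠ 0 → t.val i = j → numChildren t i = 0

open Classical in
theorem np_eq {m : ℕ} (t : IncTree m) :
    (numPitchforks t : ℚ) = ∑ j, if PF t j then 1 else 0 := by
  rw [Finset.sum_boole, numPitchforks]
  unfold PF
  congr!

theorem PF_ext_last {m : ℕ} (t : IncTree m) (j : Fin m) (hj : numChildren t j ≤ 1) :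
    ¬ PF (extT t j hj) (Fin.last m) := by
  intro h; have := h.1; rw [nc_ext_last] at this; omega

theorem PF_ext_self {m : ℕ} (t : IncTree m) (j : Fin m) (hj : numChildren t j ≤ 1) :
    PF (extT t j hj) j.castSucc ↔ numChildren t j = 0 := by
  constructor
  · intro h; have := h.1; rw [nc_ext_cast] at this; simpa using this
  · intro h
    refine ⟨by rw [nc_ext_cast]; simp [h], ?_⟩
    intro i hi0 hi
    induction i using Fin.lastCases with
    | last => exact nc_ext_last t j hj
    | cast i =>
      rw [extT_cast, Fin.castSucc_inj] at hi
      exfalso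
      rw [numChildren, Finset.card_eq_zero, Finset.filter_eq_empty_iff] at h
      exact h (mem_univ i) ⟨by simpa using hi0, hi⟩

theorem PF_ext_ne {m : ℕ} (t : IncTree m) (j : Fin m) (hj : numChildren t j ≤ 1) (k : Fin m)
    (hk : j ≠ k) :
    PF (extT t j hj) k.castSucc ↔ PF t k ∧ ¬ (j.val ≠ 0 ∧ t.1 j = k) := by
  unfold PF
  rw [nc_ext_cast, if_neg hk, add_zero, and_assoc]
  refine and_congr_right fun _ => ?_
  constructor
  · intro h
    refine ⟨fun i hi hik => ?_, ?_⟩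
    · have := h i.castSucc (by simpa using hi) (by rw [extT_cast, hik])
      rw [nc_ext_cast] at this; omega
    · rintro ⟨h0, h1⟩
      have := h j.castSucc (by simpa using h0) (by rw [extT_cast, h1])
      rw [nc_ext_cast] at this; simp at this
  · rintro ⟨h1, h2⟩ i hi0 hi
    induction i using Fin.lastCases with
    | last => exact nc_ext_last t j hj
    | cast i =>
      rw [extT_cast, Fin.castSucc_inj] at hi
      have hi0' : i.val ≠ 0 := by simpa using hi0
      rw [nc_ext_cast, h1 i hi0' hi]
      have : j ≠ i := by rintro rfl; exact h2 ⟨hi0', hi⟩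
      simp [this]

open Classical in
theorem np_ext {m : ℕ} (t : IncTree m) (j : Fin m) (hj : numChildren t j ≤ 1) :
    (numPitchforks (extT t j hj) : ℚ) = numPitchforks t + (if numChildren t j = 0 then 1 else 0)
      - (if j.val ≠ 0 ∧ PF t (t.1 j) then 1 else 0) - (if PF t j then 1 else 0) := by
  rw [np_eq, np_eq, Fin.sum_univ_castSucc, if_neg (PF_ext_last t j hj), add_zero]
  have key : ∀ k : Fin m, (if PF (extT t j hj) k.castSucc then (1:ℚ) else 0)
      = (if PF t k then 1 else 0) + (if k = j then
          ((if numChildren t j = 0 then 1 else 0) - (if PF t j then 1 else 0)) else 0)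
        - (if k = t.1 j then (if j.val ≠ 0 ∧ PF t (t.1 j) then 1 else 0) else 0) := by
    intro k
    by_cases hk : k = j
    · subst hk
      have : ¬ (k = t.1 k ∧ k.val ≠ 0) := by
        rintro ⟨h, h0⟩
        have := t.2.2.1 k h0
        rw [← h] at this; omega
      by_cases h1 : k = t.1 k
      · have h2 : k.val = 0 := by tauto
        simp [PF_ext_self, h2]
      · simp [PF_ext_self, h1]
    · rw [if_neg hk]
      simp only [PF_ext_ne t j hj k (Ne.symm hk)]
      by_cases h1 : k = t.1 j
      · rw [if_pos h1, ← h1]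
        by_cases h3 : PF t k <;> by_cases h4 : j.val = 0 <;> simp [h3, h4]
      · have : ¬ t.1 j = k := fun h => h1 h.symm
        rw [if_neg h1]
        simp only [this, and_false, not_false_eq_true, and_true, add_zero, sub_zero]
  rw [Finset.sum_congr rfl (fun k _ => key k), Finset.sum_sub_distrib, Finset.sum_add_distrib,
    Finset.sum_ite_eq' univ j, Finset.sum_ite_eq' univ (t.1 j)]
  simp only [mem_univ, if_true]
  ring

theorem sum_nc {m : ℕ} (hm : 1 ≤ m) (t : IncTree m) :
    ∑ j, (2 - (numChildren t j : ℚ)) = m + 1 := by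
  have h : ∑ j, numChildren t j = (univ.filter (fun i : Fin m => i.val ≠ 0)).card := by
    rw [Finset.card_eq_sum_card_fiberwise (f := t.1) (t := univ) (by simp)]
    simp only [Finset.filter_filter]
    rfl
  have h2 : (univ.filter (fun i : Fin m => i.val ≠ 0)).card + 1 = m := by
    obtain ⟨n, rfl⟩ : ∃ n, m = n + 1 := ⟨m - 1, by omega⟩
    have : (univ.filter (fun i : Fin (n+1) => i.val ≠ 0)) = univ.erase 0 := by
      ext i; simp only [mem_filter, mem_univ, true_and, mem_erase, and_true, ne_eq, Fin.ext_iff, Fin.val_zero]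
    rw [this, Finset.card_erase_add_one (mem_univ _)]; simp
  rw [← h] at h2
  have h3 : (∑ j, (numChildren t j : ℚ)) + 1 = m := by exact_mod_cast h2
  rw [Finset.sum_sub_distrib]
  simp
  linarith

open Classical in
theorem sum_PF_parent {m : ℕ} (t : IncTree m) :
    ∑ j : Fin m, (if j.val ≠ 0 ∧ PF t (t.1 j) then (1:ℚ) else 0) = numPitchforks t := by
  have h : ∀ j : Fin m, (if j.val ≠ 0 ∧ PF t (t.1 j) then (1:ℚ) else 0)
      = ∑ k, if PF t k then (if j.val ≠ 0 ∧ t.1 j = k then 1 else 0) else 0 := by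
    intro j
    rw [Finset.sum_eq_single (t.1 j)]
    · by_cases h3 : PF t (t.1 j) <;> by_cases h4 : j.val = 0 <;> simp [h3, h4]
    · intro b _ hb; simp [Ne.symm hb]
    · simp
  rw [Finset.sum_congr rfl (fun j _ => h j), Finset.sum_comm, np_eq]
  refine Finset.sum_congr rfl fun k _ => ?_
  by_cases hk : PF t k
  · simp only [hk, if_true]
    have := hk.1
    rw [numChildren] at this
    rw [Finset.sum_boole]
    exact_mod_cast this
  · simp [hk]

theorem sum_W {m : ℕ} (hm : 1 ≤ m) :
    ∑ t : IncTree (m+1), (2:ℚ) ^ (m + 1 - numLeaves t)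
      = (m + 1) * ∑ t : IncTree m, (2:ℚ) ^ (m - numLeaves t) := by
  rw [sum_tree hm _ (fun t _ => 2 ^ (m - numLeaves t)) w_ext, Finset.mul_sum]
  refine Finset.sum_congr rfl fun t _ => ?_
  rw [← Finset.sum_mul, sum_nc hm]

theorem sum_L {m : ℕ} (hm : 1 ≤ m) :
    ∑ t : IncTree (m+1), (numLeaves t : ℚ) * (2:ℚ) ^ (m + 1 - numLeaves t)
      = (m - 1) * ∑ t : IncTree m, (numLeaves t : ℚ) * (2:ℚ) ^ (m - numLeaves t)
        + (m + 1) * ∑ t : IncTree m, (2:ℚ) ^ (m - numLeaves t) := by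
  rw [sum_tree hm _ (fun t j => (numLeaves t + numChildren t j) * 2 ^ (m - numLeaves t)),
    Finset.mul_sum, Finset.mul_sum, ← Finset.sum_add_distrib]
  · refine Finset.sum_congr rfl fun t _ => ?_
    have h : ∀ j, (2 - (numChildren t j : ℚ)) * ((numLeaves t + numChildren t j) * 2 ^ (m - numLeaves t))
       = ((2 - (numChildren t j : ℚ)) * (numLeaves t + 1)
          - 2 * (if numChildren t j = 0 then 1 else 0)) * 2 ^ (m - numLeaves t) := by
      intro j
      have := t.2.2.2 j
      change numChildren t j ≤ 2 at this
      interval_cases numChildren t j <;> norm_num <;> ring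
    rw [Finset.sum_congr rfl (fun j _ => h j), ← Finset.sum_mul, Finset.sum_sub_distrib,
      ← Finset.sum_mul, sum_nc hm, ← Finset.mul_sum, ← nl_eq]
    ring
  · intro t j hj
    rw [w_ext, nl_ext]; push_cast; ring

theorem sum_S {m : ℕ} (hm : 1 ≤ m) :
    ∑ t : IncTree (m+1), (numPitchforks t : ℚ) * (2:ℚ) ^ (m + 1 - numLeaves t)
      = (m - 2) * ∑ t : IncTree m, (numPitchforks t : ℚ) * (2:ℚ) ^ (m - numLeaves t)
        + 2 * ∑ t : IncTree m, (numLeaves t : ℚ) * (2:ℚ) ^ (m - numLeaves t) := by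
  classical
  rw [sum_tree hm _ (fun t j => (numPitchforks t + (if numChildren t j = 0 then 1 else 0)
      - (if j.val ≠ 0 ∧ PF t (t.1 j) then 1 else 0) - (if PF t j then 1 else 0))
       * 2 ^ (m - numLeaves t)),
    Finset.mul_sum, Finset.mul_sum, ← Finset.sum_add_distrib]
  · refine Finset.sum_congr rfl fun t _ => ?_
    have h : ∀ j, (2 - (numChildren t j : ℚ)) * ((numPitchforks t + (if numChildren t j = 0 then 1 else 0)
      - (if j.val ≠ 0 ∧ PF t (t.1 j) then 1 else 0) - (if PF t j then 1 else 0))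
       * 2 ^ (m - numLeaves t))
       = ((2 - (numChildren t j : ℚ)) * numPitchforks t
          + 2 * (if numChildren t j = 0 then 1 else 0)
          - 2 * (if j.val ≠ 0 ∧ PF t (t.1 j) then 1 else 0)
          - (if PF t j then 1 else 0)) * 2 ^ (m - numLeaves t) := by
      intro j
      have h1 : (2 - (numChildren t j : ℚ)) * (if numChildren t j = 0 then 1 else 0)
          = 2 * (if numChildren t j = 0 then 1 else 0) := by
        split_ifs with h <;> simp [h]
      have h2 : (2 - (numChildren t j : ℚ)) * (if j.val ≠ 0 ∧ PF t (t.1 j) then 1 else 0)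
          = 2 * (if j.val ≠ 0 ∧ PF t (t.1 j) then 1 else 0) := by
        split_ifs with h
        · simp [h.2.2 j h.1 rfl]
        · simp
      have h3 : (2 - (numChildren t j : ℚ)) * (if PF t j then 1 else 0)
          = (if PF t j then 1 else 0) := by
        split_ifs with h
        · rw [h.1]; norm_num
        · simp
      linear_combination (2:ℚ) ^ (m - numLeaves t) * (h1 - h2 - h3)
    rw [Finset.sum_congr rfl (fun j _ => h j), ← Finset.sum_mul, Finset.sum_sub_distrib,
      Finset.sum_sub_distrib, Finset.sum_add_distrib,
      ← Finset.sum_mul, sum_nc hm, ← Finset.mul_sum, ← Finset.mul_sum, ← nl_eq, ← np_eq,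
      sum_PF_parent]
    ring
  · intro t j hj
    rw [w_ext, np_ext]; ring

instance uniqOne : Unique (IncTree 1) where
  default := ⟨id, by simp, fun i h => by omega, fun j => by
    refine le_trans (Finset.card_le_univ _) (by simp)⟩
  uniq t := by apply Subtype.ext; funext i; exact Subsingleton.elim _ _

theorem nc_one (t : IncTree 1) (j : Fin 1) : numChildren t j = 0 := by
  rw [numChildren, Finset.card_eq_zero, Finset.filter_eq_empty_iff]
  intro i _ h; omega

theorem nl_one (t : IncTree 1) : numLeaves t = 1 := by
  simp [numLeaves, nc_one]

theorem np_one (t : IncTree 1) : numPitchforks t = 0 := by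
  simp [numPitchforks, nc_one]

theorem W_val {m : ℕ} (hm : 1 ≤ m) :
    ∑ t : IncTree m, (2:ℚ) ^ (m - numLeaves t) = m.factorial := by
  induction m, hm using Nat.le_induction with
  | base => simp [nl_one, Fintype.card_unique]
  | succ m hm ih => rw [sum_W hm, ih, Nat.factorial_succ]; push_cast; ring

theorem L_val {m : ℕ} (hm : 2 ≤ m) :
    ∑ t : IncTree m, (numLeaves t : ℚ) * (2:ℚ) ^ (m - numLeaves t)
      = m.factorial * (m + 1) / 3 := by
  induction m, hm using Nat.le_induction with
  | base => rw [sum_L le_rfl, W_val le_rfl]; norm_num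
  | succ m hm ih =>
    rw [sum_L (by omega), ih, W_val (by omega), Nat.factorial_succ]; push_cast; ring

theorem expected_pitchforks_recursion :
    expPitchforks 2 = 1 ∧
    ∀ m : ℕ, 2 ≤ m →
      ((m : ℚ) + 1) * expPitchforks (m + 1) =
        ((m : ℚ) - 2) * expPitchforks m + 2 * ((m : ℚ) + 1) / 3 := by
  constructor
  · rw [expPitchforks, sum_S le_rfl]
    simp [nl_one, np_one, Fintype.card_unique]
  · intro m hm
    have hf : (m.factorial : ℚ) ≠ 0 := by exact_mod_cast m.factorial_ne_zero
    have hm1 : (m : ℚ) + 1 ≠ 0 := by positivity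
    rw [expPitchforks, expPitchforks, sum_S (by omega), L_val hm, Nat.factorial_succ]
    push_cast
    field_simp
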